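/- arXiv:2510.01110 — 2 statements merged into one kernel-verified Lean document; each statement's English description precedes it below -/
import Mathlib

section
/- Let n be even and M ∈ M_n. If M is not a switch of any perfect matching N ∈ M_n, then M = M⁺ = {(1,2), (3,4), …, (n−1,n)}. Equivalently, if for every two edges e = (w,x) and e' = (y,z) of M (with w < x, y < z) the real intervals [w,x] and [y,z] are disjoint, then M = M⁺. -/
/-- `M` is a perfect matching of the complete graph on `Fin n`. -/
def IsPerfectMatchingOn (n : ℕ) (M : Finset (Sym2 (Fin n))) : Prop :=
  (∀ e ∈ M, ¬ e.IsDiag) ∧ ∀ v : Fin n, ∃! e, e ∈ M ∧ v ∈ e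

/-- `N` is a switch of `M`: the symmetric difference `M △ N` is a single
4-cycle on vertices `w < x < y < z`, of one of the three types. -/
def IsSwitch {n : ℕ} (N M : Finset (Sym2 (Fin n))) : Prop :=
  ∃ w x y z : Fin n, w < x ∧ x < y ∧ y < z ∧
    ((M \ N = {s(w, x), s(y, z)} ∧ N \ M = {s(w, y), s(x, z)}) ∨
     (M \ N = {s(w, y), s(x, z)} ∧ N \ M = {s(w, z), s(x, y)}) ∨
     (M \ N = {s(w, x), s(y, z)} ∧ N \ M = {s(w, z), s(x, y)}))

/-- The matching `M⁺ = {(1,2), (3,4), …, (n−1,n)}` (0-indexed: pairs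
`{u, u+1}` with `u` even). -/
def Mplus (n : ℕ) : Finset (Sym2 (Fin n)) :=
  Finset.univ.filter
    (fun e => ∃ u v : Fin n, e = s(u, v) ∧ (u : ℕ) % 2 = 0 ∧ (v : ℕ) = (u : ℕ) + 1)

namespace IsPerfectMatchingOn

variable {n : ℕ} {M : Finset (Sym2 (Fin n))}

theorem eq_of_mem (hM : IsPerfectMatchingOn n M) {v : Fin n} {e e' : Sym2 (Fin n)}
    (he : e ∈ M) (hv : v ∈ e) (he' : e' ∈ M) (hv' : v ∈ e') : e = e' :=
  (hM.2 v).unique ⟨he, hv⟩ ⟨he', hv'⟩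

/-- Every perfect matching is given by a fixed-point-free involution, sending a vertex to
its partner. -/
theorem exists_partner (hM : IsPerfectMatchingOn n M) :
    ∃ f : Fin n → Fin n, (∀ a b, s(a, b) ∈ M ↔ f a = b) ∧ (∀ a, f (f a) = a) ∧
      ∀ a, f a ≠ a := by
  have hex (a : Fin n) : ∃ b, s(a, b) ∈ M := by
    obtain ⟨e, ⟨he, b, rfl⟩, -⟩ := hM.2 a
    exact ⟨b, he⟩
  choose f hf using hex
  have hiff (a b : Fin n) : s(a, b) ∈ M ↔ f a = b := by
    refine ⟨fun h => ?_, fun h => h ▸ hf a⟩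
    exact Sym2.congr_right.1 (hM.eq_of_mem (hf a) (Sym2.mem_mk_left _ _) h
      (Sym2.mem_mk_left _ _))
  refine ⟨f, hiff, fun a => (hiff _ _).1 (Sym2.eq_swap ▸ hf a), fun a h => ?_⟩
  exact hM.1 _ (hf a) (Sym2.mk_isDiag_iff.2 h.symm)

/-- Two edges `ab`, `cd` of a perfect matching may be exchanged for `ac`, `bd`. -/
theorem exists_exchange (hM : IsPerfectMatchingOn n M) {a b c d : Fin n}
    (hab : s(a, b) ∈ M) (hcd : s(c, d) ∈ M) (hne : s(a, b) ≠ s(c, d)) :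
    ∃ N, IsPerfectMatchingOn n N ∧ M \ N = {s(a, b), s(c, d)} ∧
      N \ M = {s(a, c), s(b, d)} := by
  obtain ⟨f, hf, hff, hfne⟩ := hM.exists_partner
  obtain rfl := (hf _ _).1 hab
  obtain rfl := (hf _ _).1 hcd
  have hac : a ≠ c := fun h => hne (by rw [h])
  have hafc : a ≠ f c := fun h => hne (by rw [h, hff, Sym2.eq_swap])
  have hfac : f a ≠ c := fun h => hafc (by rw [← h, hff])
  have hfafc : f a ≠ f c := fun h => hac (by rw [← hff a, h, hff])
  have hac' : s(a, c) ∉ M := by rwa [hf]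
  have hbd' : s(f a, f c) ∉ M := by rwa [hf, hff]
  have ha := hfne a
  have hc := hfne c
  refine ⟨(M \ {s(a, f a), s(c, f c)}) ∪ {s(a, c), s(f a, f c)}, ⟨?_, fun v => ?_⟩, ?_, ?_⟩
  · intro e he
    simp only [Finset.mem_union, Finset.mem_sdiff, Finset.mem_insert,
      Finset.mem_singleton] at he
    rcases he with he | rfl | rfl
    · exact hM.1 e he.1
    · simpa using hac
    · simpa using hfafc
  · by_cases hv : v ∈ s(a, c)
    · refine ⟨s(a, c), ⟨by simp, hv⟩, ?_⟩
      rintro ⟨p, q⟩ ⟨he, hve⟩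
      simp only [Finset.mem_union, Finset.mem_sdiff, Finset.mem_insert, Finset.mem_singleton,
        Sym2.mem_iff, Sym2.eq_iff, hf] at he hve hv ⊢
      grind
    by_cases hv' : v ∈ s(f a, f c)
    · refine ⟨s(f a, f c), ⟨by simp, hv'⟩, ?_⟩
      rintro ⟨p, q⟩ ⟨he, hve⟩
      simp only [Finset.mem_union, Finset.mem_sdiff, Finset.mem_insert, Finset.mem_singleton,
        Sym2.mem_iff, Sym2.eq_iff, hf] at he hve hv hv' ⊢
      grind
    refine ⟨s(v, f v), ⟨?_, Sym2.mem_mk_left _ _⟩, ?_⟩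
    · simp only [Finset.mem_union, Finset.mem_sdiff, Finset.mem_insert, Finset.mem_singleton,
        Sym2.mem_iff, Sym2.eq_iff, hf] at hv hv' ⊢
      grind
    · rintro ⟨p, q⟩ ⟨he, hve⟩
      simp only [Finset.mem_union, Finset.mem_sdiff, Finset.mem_insert, Finset.mem_singleton,
        Sym2.mem_iff, Sym2.eq_iff, hf] at he hve hv hv' ⊢
      grind
  · ext e
    simp only [Finset.mem_union, Finset.mem_sdiff, Finset.mem_insert, Finset.mem_singleton]
    grind
  · ext e
    simp only [Finset.mem_union, Finset.mem_sdiff, Finset.mem_insert, Finset.mem_singleton]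
    grind

/-- A matching which is not a switch has no pair of edges whose intervals cross or are nested. -/
theorem partner_le_of_not_isSwitch (hM : IsPerfectMatchingOn n M)
    (hno : ∀ N : Finset (Sym2 (Fin n)), IsPerfectMatchingOn n N → ¬ IsSwitch M N)
    {w x p q : Fin n} (hwp : s(w, p) ∈ M) (hxq : s(x, q) ∈ M) (hwx : w < x) (hxp : x < p) :
    q ≤ x := by
  by_contra! hq
  have hne : s(w, p) ≠ s(x, q) := by
    rw [Ne, Sym2.eq_iff]
    grind
  obtain ⟨N, hN, hMN, hNM⟩ := hM.exists_exchange hwp hxq hne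
  rcases lt_trichotomy p q with hpq | rfl | hqp
  · exact hno N hN ⟨w, x, p, q, hwx, hxp, hpq, .inl ⟨hNM, hMN⟩⟩
  · have := hM.eq_of_mem hwp (Sym2.mem_mk_right _ _) hxq (Sym2.mem_mk_right _ _)
    exact hne this
  · exact hno N hN ⟨w, x, q, p, hwx, hq, hqp, .inr (.inr ⟨by rw [hNM, Sym2.eq_swap (a := q)], hMN⟩)⟩

end IsPerfectMatchingOn

/-- If `M` is not a switch of any perfect matching `N`, then `M = M⁺`. -/
theorem stmt_10 {n : ℕ} (hn : Even n) (M : Finset (Sym2 (Fin n)))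
    (hM : IsPerfectMatchingOn n M)
    (hno : ∀ N : Finset (Sym2 (Fin n)), IsPerfectMatchingOn n N → ¬ IsSwitch M N) :
    M = Mplus n := by
  obtain ⟨f, hf, hff, hfne⟩ := hM.exists_partner
  have key (k : ℕ) : ∀ u : Fin n, (u : ℕ) = k → k % 2 = 0 → (f u : ℕ) = k + 1 := by
    induction k using Nat.strong_induction_on with
    | _ k ih =>
      rintro u rfl hk
      have below (v : Fin n) (hv : v < u) : f v < u := by
        rcases Nat.mod_two_eq_zero_or_one v with h | h
        · have := ih v hv v rfl h
          omega
        · obtain ⟨v', hv'⟩ : ∃ v' : Fin n, (v' : ℕ) + 1 = v := ⟨⟨v - 1, by omega⟩, by simp; omega⟩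
          have h1 : f v' = v := Fin.ext ((ih v' (by omega) v' rfl (by omega)).trans hv')
          rw [← h1, hff]
          omega
      have not_below (v : Fin n) (hv : u ≤ v) : u ≤ f v := by
        by_contra! h
        have := below _ h
        rw [hff] at this
        omega
      have hu := not_below u le_rfl
      have hne := hfne u
      by_contra hlt
      obtain ⟨x, hx⟩ : ∃ x : Fin n, (x : ℕ) = u + 1 := ⟨⟨u + 1, by omega⟩, rfl⟩
      have hfx := hM.partner_le_of_not_isSwitch hno ((hf u _).2 rfl) ((hf x _).2 rfl)
        (by omega) (by omega)
      have hx' := not_below x (by omega)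
      have hxne := hfne x
      have hfxu : f x ≠ u := fun h => by
        have := hff x
        rw [h] at this
        omega
      omega
  ext e
  simp only [Mplus, Finset.mem_filter, Finset.mem_univ, true_and]
  constructor
  · induction e using Sym2.ind with
    | _ a b =>
      intro he
      obtain rfl := (hf _ _).1 he
      rcases Nat.mod_two_eq_zero_or_one a with h | h
      · exact ⟨a, f a, rfl, h, key a a rfl h⟩
      · obtain ⟨c, hc⟩ : ∃ c : Fin n, (c : ℕ) + 1 = a := ⟨⟨a - 1, by omega⟩, by simp; omega⟩
        have h1 : f c = a := Fin.ext ((key c c rfl (by omega)).trans hc)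
        refine ⟨c, a, ?_, by omega, hc.symm⟩
        rw [← h1, hff, Sym2.eq_swap]
  · rintro ⟨u, v, rfl, hu, hv⟩
    exact (hf _ _).2 (Fin.ext ((key u u rfl hu).trans hv.symm))
end

section
/- Fix an even n ∈ ℕ. Suppose that for all M, N ∈ M_n with N ⪯ M there exists a finite sequence N = M_1, M_2, …, M_k = M in M_n such that M_j is a switch of M_{j+1} for each j ∈ {1,…,k−1}. Then the preorder ⪯ on M_n is antisymmetric: for all M, N ∈ M_n, if M ⪯ N and N ⪯ M then M = N. -/
/-- `(d_1, …, d_n)` can realize the matching `M`: there is a simple graph `G`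
on `[n]` with `deg_G(i) = d i` and `M ⊆ E(G)`. -/
def Realizes {n : ℕ} (d : Fin n → ℕ) (M : Finset (Sym2 (Fin n))) : Prop :=
  ∃ G : SimpleGraph (Fin n), (∀ i, (G.neighborSet i).ncard = d i) ∧
    ∀ e ∈ M, e ∈ G.edgeSet

/-- `N ⪯ M`: every weakly decreasing degree sequence realizing `M` also
realizes `N`. -/
def Preceq {n : ℕ} (N M : Finset (Sym2 (Fin n))) : Prop :=
  ∀ d : Fin n → ℕ, Antitone d → Realizes d M → Realizes d N

/-- The product of the endpoints of an edge, as a natural number. -/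
def edgeWeight {n : ℕ} (e : Sym2 (Fin n)) : ℕ :=
  Sym2.lift ⟨fun i j : Fin n => (i : ℕ) * j, fun _ _ => Nat.mul_comm _ _⟩ e

@[simp] theorem edgeWeight_mk {n : ℕ} (i j : Fin n) : edgeWeight s(i, j) = (i : ℕ) * j := rfl

theorem IsSwitch.sum_edgeWeight_lt {n : ℕ} {N M : Finset (Sym2 (Fin n))} (h : IsSwitch N M) :
    ∑ e ∈ N, edgeWeight e < ∑ e ∈ M, edgeWeight e := by
  obtain ⟨w, x, y, z, hwx, hxy, hyz, h⟩ := h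
  rw [← Finset.sum_sdiff_lt_sum_sdiff]
  have h₁ : s(w, x) ≠ s(y, z) := by
    simp [(hwx.trans hxy).ne, (hwx.trans (hxy.trans hyz)).ne]
  have h₂ : s(w, y) ≠ s(x, z) := by
    simp [hwx.ne, (hwx.trans (hxy.trans hyz)).ne]
  have h₃ : s(w, z) ≠ s(x, y) := by
    simp [hwx.ne, (hwx.trans hxy).ne]
  have e₁ : (w * y + x * z : ℕ) < w * x + y * z := by
    rw [Fin.lt_def] at hwx hxy hyz
    nlinarith
  have e₂ : (w * z + x * y : ℕ) < w * y + x * z := by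
    rw [Fin.lt_def] at hwx hxy hyz
    nlinarith
  rcases h with ⟨hM, hN⟩ | ⟨hM, hN⟩ | ⟨hM, hN⟩ <;> rw [hM, hN] <;>
    simp only [Finset.sum_pair h₁, Finset.sum_pair h₂, Finset.sum_pair h₃, edgeWeight_mk]
  · exact e₁
  · exact e₂
  · exact e₂.trans e₁

theorem transGen_isSwitch_sum_edgeWeight_lt {n : ℕ} {N M : Finset (Sym2 (Fin n))}
    (h : Relation.TransGen (fun A B : Finset (Sym2 (Fin n)) => IsSwitch A B) N M) :
    ∑ e ∈ N, edgeWeight e < ∑ e ∈ M, edgeWeight e := by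
  induction h with
  | single h => exact h.sum_edgeWeight_lt
  | tail _ h ih => exact ih.trans h.sum_edgeWeight_lt

theorem stmt_12 {n : ℕ} (hn : Even n)
    (hchain : ∀ M N : Finset (Sym2 (Fin n)), IsPerfectMatchingOn n M →
      IsPerfectMatchingOn n N → Preceq N M →
      Relation.ReflTransGen (fun A B : Finset (Sym2 (Fin n)) => IsSwitch A B) N M) :
    ∀ M N : Finset (Sym2 (Fin n)), IsPerfectMatchingOn n M →
      IsPerfectMatchingOn n N → Preceq M N → Preceq N M → M = N := by
  intro M N hM hN hMN hNM
  rcases Relation.reflTransGen_iff_eq_or_transGen.1 (hchain N M hN hM hMN) with h | h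
  · exact h.symm
  rcases Relation.reflTransGen_iff_eq_or_transGen.1 (hchain M N hM hN hNM) with h' | h'
  · exact h'
  exact absurd (transGen_isSwitch_sum_edgeWeight_lt h)
    (transGen_isSwitch_sum_edgeWeight_lt h').asymm
end
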